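/- Let r ≥ 2, let F be the free group of rank r, and let P ⊆ F (a property of elements of F). Suppose there exist v ∈ F and a subset A ⊆ F that is exponentially generic in F such that no element w ∈ A whose cyclic reduction contains v as a subword lies in P. Then P is exponentially rare in F. -/

import Mathlib

namespace VG

variable {r : ℕ}

/-- Word length: the length of the unique freely reduced word representing `w`. -/
def len (w : FreeGroup (Fin r)) : ℕ := (FreeGroup.toWord w).length

/-- The number of elements of `A` of word length at most `n`. -/
noncomputable def ballCount (A : Set (FreeGroup (Fin r))) (n : ℕ) : ℕ :=
  {w | w ∈ A ∧ len w ≤ n}.ncard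

/-- The number of elements of `A` of word length exactly `n`. -/
noncomputable def sphereCount (A : Set (FreeGroup (Fin r))) (n : ℕ) : ℕ :=
  {w | w ∈ A ∧ len w = n}.ncard

/-- `A` is exponentially generic in `B`: there are `a > 0` and `b` such that, for all
sufficiently large `n`, the proportion of elements of `B` of length at most `n` lying
in `A` is at least `1 - exp (b - a n)`. -/
def ExpGeneric (A B : Set (FreeGroup (Fin r))) : Prop :=
  ∃ a : ℝ, 0 < a ∧ ∃ b : ℝ, ∃ N : ℕ, ∀ n : ℕ, N ≤ n →
    (1 : ℝ) - Real.exp (b - a * n) ≤ (ballCount A n : ℝ) / (ballCount B n)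

/-- `A` is exponentially rare in `B` if its complement in `B` is exponentially generic. -/
def ExpRare (A B : Set (FreeGroup (Fin r))) : Prop := ExpGeneric (B \ A) B

/-- `v` is a subword of `w`: the reduced word of `v` is a contiguous sublist of that of `w`. -/
def Subword (v w : FreeGroup (Fin r)) : Prop :=
  FreeGroup.toWord v <:+: FreeGroup.toWord w

/-- `w` is cyclically reduced: the first letter of its reduced word is not the inverse of
the last letter. -/
def CyclicallyReduced (w : FreeGroup (Fin r)) : Prop :=
  ∀ a ∈ (FreeGroup.toWord w).head?, ∀ b ∈ (FreeGroup.toWord w).getLast?,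
    a ≠ (b.1, !b.2)

/-- `c` is the cyclic reduction of `w`: it is cyclically reduced and conjugate to `w`. -/
def IsCyclicReduction (c w : FreeGroup (Fin r)) : Prop :=
  CyclicallyReduced c ∧ ∃ g : FreeGroup (Fin r), w = g * c * g⁻¹

/-- Middle third of a list: delete the first and last `⌈l/3⌉` entries. -/
def middleThird {α : Type*} (l : List α) : List α :=
  (l.drop ((l.length + 2) / 3)).take (l.length - 2 * ((l.length + 2) / 3))

/-- `v` is cyclically contained in `w` if the reduced word of `v` is a subword of some
positive power of the cyclic reduction of `w`. -/
def CyclicallyContains (w v : FreeGroup (Fin r)) : Prop :=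
  ∃ c : FreeGroup (Fin r), IsCyclicReduction c w ∧ ∃ k : ℕ, 1 ≤ k ∧ Subword v (c ^ k)

/-- `w` is full: every freely reduced word of length 3, or its inverse, is cyclically
contained in `w`. -/
def Full (w : FreeGroup (Fin r)) : Prop :=
  ∀ t : FreeGroup (Fin r), len t = 3 → CyclicallyContains w t ∨ CyclicallyContains w t⁻¹

/-- The group element corresponding to a single letter. -/
def letterElem (a : Fin r × Bool) : FreeGroup (Fin r) := FreeGroup.mk [a]

/-- The inverse of a letter. -/
def linv (a : Fin r × Bool) : Fin r × Bool := (a.1, !a.2)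

/-- `w` is a proper power: `w = u^k` for some `k ≥ 2`. -/
def ProperPower (w : FreeGroup (Fin r)) : Prop :=
  ∃ u : FreeGroup (Fin r), ∃ k : ℕ, 2 ≤ k ∧ w = u ^ k

/-- Minimal word length in the conjugacy class of `w`. -/
noncomputable def conjMinLen (w : FreeGroup (Fin r)) : ℕ :=
  sInf (len '' {u | IsConj u w})

/-- `w` is Whitehead minimal: for every automorphism `α` of the free group, the length of
`w` is at most the minimal length of an element conjugate to `α w`. -/
def WhiteheadMinimal (w : FreeGroup (Fin r)) : Prop :=
  ∀ α : FreeGroup (Fin r) ≃* FreeGroup (Fin r), len w ≤ conjMinLen (α w)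


/-- Reduced words of length `n` that may follow the letter `a`. -/
def extW (a : Fin r × Bool) : ℕ → Finset (List (Fin r × Bool))
  | 0 => {[]}
  | n + 1 => (Finset.univ.filter (fun b : Fin r × Bool => b ≠ (a.1, !a.2))).biUnion
      (fun b => (extW b n).image (fun l => b :: l))

theorem rel_iff (a b : Fin r × Bool) : (a.1 = b.1 → a.2 = b.2) ↔ b ≠ (a.1, !a.2) := by
  obtain ⟨a1, a2⟩ := a
  obtain ⟨b1, b2⟩ := b
  cases a2 <;> cases b2 <;> simp [eq_comm]

theorem mem_extW (n : ℕ) : ∀ (a : Fin r × Bool) (e : List (Fin r × Bool)),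
    e ∈ extW a n ↔ e.length = n ∧ FreeGroup.IsReduced (a :: e) := by
  induction n with
  | zero =>
    intro a e
    simp only [extW, Finset.mem_singleton, List.length_eq_zero_iff]
    constructor
    · rintro rfl; simp
    · exact fun h => h.1
  | succ n ih =>
    intro a e
    simp only [extW, Finset.mem_biUnion, Finset.mem_filter, Finset.mem_univ, true_and,
      Finset.mem_image]
    constructor
    · rintro ⟨b, hb, l, hl, rfl⟩
      have := (ih b l).1 hl
      refine ⟨by simp [this.1], ?_⟩
      rw [FreeGroup.isReduced_cons_cons, rel_iff]
      exact ⟨hb, this.2⟩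
    · rintro ⟨h1, h2⟩
      cases e with
      | nil => simp at h1
      | cons b l =>
        rw [FreeGroup.isReduced_cons_cons, rel_iff] at h2
        exact ⟨b, h2.1, l, (ih b l).2 ⟨by simpa using h1, h2.2⟩, rfl⟩

theorem card_extW (n : ℕ) : ∀ (a : Fin r × Bool), (extW a n).card = (2 * r - 1) ^ n := by
  induction n with
  | zero => intro a; simp [extW]
  | succ n ih =>
    intro a
    rw [extW, Finset.card_biUnion]
    · rw [Finset.sum_congr rfl (g := fun _ => (2 * r - 1) ^ n)]
      · rw [Finset.sum_const, Finset.filter_ne', Finset.card_erase_of_mem (Finset.mem_univ _)]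
        simp [Fintype.card_prod, pow_succ, mul_comm]
      · intro b _
        rw [Finset.card_image_of_injective _ (fun x y h => by simpa using h), ih]
    · intro b _ c _ hbc
      rw [Function.onFun, Finset.disjoint_left]
      intro l h1 h2
      simp only [Finset.mem_image] at h1 h2
      obtain ⟨x, _, rfl⟩ := h1
      obtain ⟨y, _, h⟩ := h2
      simp at h
      exact hbc h.1.symm

open Classical in
/-- Those extensions which avoid `v`. -/
noncomputable def avW (v : List (Fin r × Bool)) (a : Fin r × Bool) (n : ℕ) :
    Finset (List (Fin r × Bool)) := (extW a n).filter (fun e => ¬ v <:+: e)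

theorem mem_avW (v : List (Fin r × Bool)) (a : Fin r × Bool) (n : ℕ) (e) :
    e ∈ avW v a n ↔ (e.length = n ∧ FreeGroup.IsReduced (a :: e)) ∧ ¬ v <:+: e := by
  rw [avW, Finset.mem_filter, mem_extW]

theorem card_avW_le (v : List (Fin r × Bool)) (a : Fin r × Bool) (n : ℕ) :
    (avW v a n).card ≤ (2 * r - 1) ^ n := by
  rw [← card_extW n a]
  exact Finset.card_le_card (Finset.filter_subset _ _)

theorem exists_letter (hr : 2 ≤ r) (a b : Fin r × Bool) : ∃ x : Fin r × Bool, x ≠ a ∧ x ≠ b := by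
  have h : ({a, b} : Finset (Fin r × Bool)).card < (Finset.univ : Finset (Fin r × Bool)).card := by
    refine lt_of_le_of_lt Finset.card_le_two ?_
    simp [Fintype.card_prod]; omega
  obtain ⟨x, _, hx⟩ := Finset.exists_mem_notMem_of_card_lt_card h
  exact ⟨x, by simpa using hx⟩

theorem card_avW_lt (hr : 2 ≤ r) (v : List (Fin r × Bool)) (hv : FreeGroup.IsReduced v)
    (a : Fin r × Bool) :
    (avW v a (v.length + 1)).card + 1 ≤ (2 * r - 1) ^ (v.length + 1) := by
  rw [← card_extW _ a]
  apply Finset.card_lt_card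
  unfold avW
  rw [Finset.ssubset_iff_of_subset (Finset.filter_subset _ _)]
  have : ∃ x : Fin r × Bool, FreeGroup.IsReduced (a :: x :: v) := by
    cases v with
    | nil => exact ⟨a, by simp⟩
    | cons c l =>
      obtain ⟨x, h1, h2⟩ := exists_letter hr (a.1, !a.2) (c.1, !c.2)
      refine ⟨x, ?_⟩
      rw [FreeGroup.isReduced_cons_cons, FreeGroup.isReduced_cons_cons, rel_iff, rel_iff]
      refine ⟨h1, ?_, hv⟩
      rintro rfl
      simp at h2
  obtain ⟨x, hx⟩ := this
  refine ⟨x :: v, (mem_extW _ _ _).2 ⟨by simp, hx⟩, ?_⟩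
  simp only [Finset.mem_filter, not_and, not_not]
  exact fun _ => ⟨[x], [], by simp⟩

theorem card_avW_add (v : List (Fin r × Bool)) (a : Fin r × Bool) (s m M : ℕ)
    (hM : ∀ b, (avW v b m).card ≤ M) :
    (avW v a (s + m)).card ≤ (avW v a s).card * M := by
  classical
  have hsub : avW v a (s + m) ⊆ (avW v a s).biUnion (fun u =>
      (avW v ((a :: u).getLast (by simp)) m).image (fun t => u ++ t)) := by
    intro e he
    rw [mem_avW] at he
    obtain ⟨⟨h1, h2⟩, h3⟩ := he
    have hsplit : e.take s ++ e.drop s = e := List.take_append_drop s e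
    simp only [Finset.mem_biUnion, Finset.mem_image, mem_avW]
    refine ⟨e.take s, ⟨⟨by simp [h1], ?_⟩, ?_⟩, e.drop s, ⟨⟨by simp [h1], ?_⟩, ?_⟩, hsplit⟩
    · exact h2.infix ⟨[], e.drop s, by simp⟩
    · exact fun h => h3 (h.trans ⟨[], e.drop s, by simp⟩)
    · refine h2.infix ⟨(a :: e.take s).dropLast, [], ?_⟩
      have := List.dropLast_append_getLast (l := a :: e.take s) (by simp)
      rw [List.append_nil, List.append_cons, this]
      simp
    · exact fun h => h3 (h.trans ⟨e.take s, [], by simp⟩)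
  refine (Finset.card_le_card hsub).trans ?_
  refine Finset.card_biUnion_le_card_mul _ _ _ ?_
  intro u _
  exact Finset.card_image_le.trans (hM _)

theorem card_avW_bound (hr : 2 ≤ r) (v : List (Fin r × Bool)) (hv : FreeGroup.IsReduced v)
    (t : ℝ) (ht1 : 1 ≤ t)
    (htL : ((2 * r - 1 : ℕ) : ℝ) ^ (v.length + 1) - 1 ≤ t ^ (v.length + 1)) (m : ℕ) :
    ∀ a, ((avW v a m).card : ℝ) ≤ ((2 * r - 1 : ℕ) : ℝ) ^ (v.length + 1) * t ^ m := by
  have hq : (1 : ℝ) ≤ ((2 * r - 1 : ℕ) : ℝ) := by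
    have : 1 ≤ 2 * r - 1 := by omega
    exact_mod_cast this
  induction m using Nat.strong_induction_on with
  | _ m ih =>
    intro a
    by_cases hm : m < v.length + 1
    · have h1 : ((avW v a m).card : ℝ) ≤ ((2 * r - 1 : ℕ) : ℝ) ^ m := by
        exact_mod_cast card_avW_le v a m
      have h2 : ((2 * r - 1 : ℕ) : ℝ) ^ m ≤ ((2 * r - 1 : ℕ) : ℝ) ^ (v.length + 1) :=
        pow_le_pow_right₀ hq hm.le
      have h3 : (1 : ℝ) ≤ t ^ m := one_le_pow₀ ht1
      nlinarith [pow_nonneg (zero_le_one.trans hq) (v.length + 1)]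
    · obtain ⟨k, rfl⟩ := Nat.exists_eq_add_of_le (not_lt.1 hm)
      have ihk := ih k (by omega)
      have : Nonempty (Fin r × Bool) := ⟨a⟩
      obtain ⟨b, hb⟩ := Finite.exists_max (fun b => (avW v b k).card)
      have h1 := card_avW_add v a (v.length + 1) k _ hb
      have h2 := card_avW_lt hr v hv a
      have h1' : ((avW v a (v.length + 1 + k)).card : ℝ) ≤
        ((avW v a (v.length + 1)).card : ℝ) * ((avW v b k).card : ℝ) := by exact_mod_cast h1
      have h2' : ((avW v a (v.length + 1)).card : ℝ) + 1 ≤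
        ((2 * r - 1 : ℕ) : ℝ) ^ (v.length + 1) := by exact_mod_cast h2
      calc _ ≤ _ := h1'
        _ ≤ t ^ (v.length + 1) * (((2 * r - 1 : ℕ) : ℝ) ^ (v.length + 1) * t ^ k) :=
          mul_le_mul (by linarith) (ihk b) (by positivity) (by positivity)
        _ = _ := by ring

/-- All reduced words of length `n` avoiding `v`. -/
noncomputable def allAv (v : List (Fin r × Bool)) (n : ℕ) : Finset (List (Fin r × Bool)) :=
  Finset.univ.biUnion (fun a => avW v a n)

/-- All reduced words of length `n`. -/
def allW (r : ℕ) (n : ℕ) : Finset (List (Fin r × Bool)) :=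
  Finset.univ.biUnion (fun a => extW a n)

theorem exists_pre (hr : 2 ≤ r) (e : List (Fin r × Bool)) (he : FreeGroup.IsReduced e) :
    ∃ a, FreeGroup.IsReduced (a :: e) := by
  cases e with
  | nil => exact ⟨(⟨0, by omega⟩, true), by simp⟩
  | cons b l => exact ⟨b, by simp [he]⟩

theorem mem_allAv (hr : 2 ≤ r) (v e : List (Fin r × Bool)) (he : FreeGroup.IsReduced e)
    (hv : ¬ v <:+: e) : e ∈ allAv v e.length := by
  obtain ⟨a, ha⟩ := exists_pre hr e he
  exact Finset.mem_biUnion.2 ⟨a, Finset.mem_univ _, (mem_avW _ _ _ _).2 ⟨⟨rfl, ha⟩, hv⟩⟩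

theorem mem_allW (hr : 2 ≤ r) (e : List (Fin r × Bool)) (he : FreeGroup.IsReduced e) :
    e ∈ allW r e.length := by
  obtain ⟨a, ha⟩ := exists_pre hr e he
  exact Finset.mem_biUnion.2 ⟨a, Finset.mem_univ _, (mem_extW _ _ _).2 ⟨rfl, ha⟩⟩

theorem card_allW (n : ℕ) : (allW r n).card ≤ (2 * r) * (2 * r - 1) ^ n := by
  refine (Finset.card_biUnion_le_card_mul _ _ ((2 * r - 1) ^ n) ?_).trans ?_
  · intro a _; rw [card_extW]
  · simp [mul_comm]

theorem card_allAv (v : List (Fin r × Bool)) (n : ℕ) (M : ℝ)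
    (h : ∀ a, ((avW v a n).card : ℝ) ≤ M) : ((allAv v n).card : ℝ) ≤ (2 * r : ℕ) * M := by
  have h1 : ((allAv v n).card : ℝ) ≤ ∑ a : Fin r × Bool, ((avW v a n).card : ℝ) := by
    exact_mod_cast Finset.card_biUnion_le
  refine h1.trans ((Finset.sum_le_sum (fun a _ => h a)).trans ?_)
  simp [mul_comm]

theorem finite_ball (A : Set (FreeGroup (Fin r))) (n : ℕ) : {w | w ∈ A ∧ len w ≤ n}.Finite := by
  have : {l : List (Fin r × Bool) | l.length ≤ n}.Finite := List.finite_length_le _ n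
  refine (this.preimage (FreeGroup.toWord_injective.injOn)).subset ?_
  rintro w ⟨_, hw⟩
  exact hw

theorem ball_lower (hr : 2 ≤ r) (n : ℕ) :
    (2 * r - 1) ^ n ≤ ballCount (Set.univ : Set (FreeGroup (Fin r))) n := by
  classical
  have a : Fin r × Bool := (⟨0, by omega⟩, true)
  rw [← card_extW n a, ballCount, ← Set.ncard_coe_finset]
  refine Set.ncard_le_ncard_of_injOn FreeGroup.mk ?_ ?_ (finite_ball _ _)
  · intro e he
    have he := (mem_extW _ _ _).1 (Finset.mem_coe.1 he)
    have h2 : FreeGroup.IsReduced e := he.2.infix ⟨[a], [], by simp⟩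
    simp [len, h2.reduce_eq, he.1]
  · intro e he f hf h
    have he := (mem_extW _ _ _).1 (Finset.mem_coe.1 he)
    have hf := (mem_extW _ _ _).1 (Finset.mem_coe.1 hf)
    have h2 : FreeGroup.IsReduced e := he.2.infix ⟨[a], [], by simp⟩
    have h3 : FreeGroup.IsReduced f := hf.2.infix ⟨[a], [], by simp⟩
    have := congrArg FreeGroup.toWord h
    simpa [h2.reduce_eq, h3.reduce_eq] using this

/-- Elements none of whose cyclic reductions contains `v`. -/
def badSet (v : FreeGroup (Fin r)) : Set (FreeGroup (Fin r)) :=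
  {w | ¬ ∃ c : FreeGroup (Fin r), IsCyclicReduction c w ∧ Subword v c}

theorem bad_decomp (v w : FreeGroup (Fin r)) (hw : w ∈ badSet v) :
    ∃ g c : List (Fin r × Bool), FreeGroup.IsReduced g ∧ FreeGroup.IsReduced c ∧
      ¬ v.toWord <:+: c ∧ 2 * g.length + c.length = len w ∧
      w = FreeGroup.mk (g ++ c ++ FreeGroup.invRev g) := by
  classical
  have hred : FreeGroup.IsReduced w.toWord := FreeGroup.isReduced_toWord
  have hconj := FreeGroup.reduceCyclically.conj_conjugator_reduceCyclically w.toWord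
  have hcyc := FreeGroup.reduceCyclically.isCyclicallyReduced hred
  set g := FreeGroup.reduceCyclically.conjugator w.toWord with hg
  set c := FreeGroup.reduceCyclically w.toWord with hc
  have hgr : FreeGroup.IsReduced g :=
    hred.infix ⟨[], c ++ FreeGroup.invRev g, by rw [← hconj]; simp⟩
  have hw' : w = FreeGroup.mk (g ++ c ++ FreeGroup.invRev g) := by
    rw [hconj, FreeGroup.mk_toWord]
  refine ⟨g, c, hgr, hcyc.isReduced, ?_, ?_, hw'⟩
  · intro hv
    apply hw
    refine ⟨FreeGroup.mk c, ⟨?_, FreeGroup.mk g, ?_⟩, ?_⟩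
    · intro a ha b hb
      rw [FreeGroup.toWord_mk, hcyc.isReduced.reduce_eq] at ha hb
      have := (FreeGroup.isCyclicallyReduced_iff.1 hcyc).2 b hb a ha
      exact (rel_iff b a).1 this
    · rw [FreeGroup.inv_mk, FreeGroup.mul_mk, FreeGroup.mul_mk]; exact hw'
    · rw [Subword, FreeGroup.toWord_mk, hcyc.isReduced.reduce_eq]; exact hv
  · have := congrArg List.length hconj
    simp only [List.length_append, FreeGroup.invRev_length] at this
    rw [len]; omega

theorem bad_count (hr : 2 ≤ r) (v : FreeGroup (Fin r)) (t : ℝ) (ht1 : 1 ≤ t)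
    (ht2 : ((2 * r - 1 : ℕ) : ℝ) ≤ t ^ 2)
    (htL : ((2 * r - 1 : ℕ) : ℝ) ^ (v.toWord.length + 1) - 1 ≤ t ^ (v.toWord.length + 1)) :
    ∃ D : ℝ, 0 ≤ D ∧ ∀ n : ℕ, (ballCount (badSet v) n : ℝ) ≤ D * ((n + 1 : ℝ) ^ 2 * t ^ n) := by
  classical
  refine ⟨(2 * r : ℕ) * ((2 * r : ℕ) * ((2 * r - 1 : ℕ) : ℝ) ^ (v.toWord.length + 1)),
    by positivity, fun n => ?_⟩
  set C := ((2 * r - 1 : ℕ) : ℝ) ^ (v.toWord.length + 1) with hC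
  let I : Finset (ℕ × ℕ) := (Finset.range (n + 1) ×ˢ Finset.range (n + 1)).filter
    (fun p => 2 * p.1 + p.2 ≤ n)
  let f : List (Fin r × Bool) × List (Fin r × Bool) → FreeGroup (Fin r) :=
    fun p => FreeGroup.mk (p.1 ++ p.2 ++ FreeGroup.invRev p.1)
  let T : Finset (FreeGroup (Fin r)) := I.biUnion (fun p =>
    (allW r p.1 ×ˢ allAv v.toWord p.2).image f)
  have hsub : {w | w ∈ badSet v ∧ len w ≤ n} ⊆ (T : Set (FreeGroup (Fin r))) := by
    rintro w ⟨hw, hn⟩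
    obtain ⟨g, c, hg, hc, hvc, hl, hw'⟩ := bad_decomp v w hw
    rw [Finset.mem_coe, Finset.mem_biUnion]
    refine ⟨(g.length, c.length), ?_, Finset.mem_image.2 ⟨(g, c), ?_, hw'.symm⟩⟩
    · simp only [I, Finset.mem_filter, Finset.mem_product, Finset.mem_range]; omega
    · exact Finset.mem_product.2 ⟨mem_allW hr g hg, mem_allAv hr _ c hc hvc⟩
  have h1 : ballCount (badSet v) n ≤ T.card := by
    rw [ballCount, ← Set.ncard_coe_finset]
    exact Set.ncard_le_ncard hsub (Finset.finite_toSet _)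
  have h2 : (T.card : ℝ) ≤ ∑ p ∈ I, ((allW r p.1).card : ℝ) * ((allAv v.toWord p.2).card : ℝ) := by
    have : T.card ≤ ∑ p ∈ I, (allW r p.1).card * (allAv v.toWord p.2).card := by
      refine Finset.card_biUnion_le.trans (Finset.sum_le_sum (fun p _ => ?_))
      rw [← Finset.card_product]; exact Finset.card_image_le
    exact_mod_cast this
  have h3 : ∀ p ∈ I, ((allW r p.1).card : ℝ) * ((allAv v.toWord p.2).card : ℝ) ≤
      (2 * r : ℕ) * ((2 * r : ℕ) * C) * t ^ n := by
    intro p hp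
    have hp : 2 * p.1 + p.2 ≤ n := (Finset.mem_filter.1 hp).2
    have e1 : ((allW r p.1).card : ℝ) ≤ (2 * r : ℕ) * ((2 * r - 1 : ℕ) : ℝ) ^ p.1 := by
      exact_mod_cast card_allW p.1
    have e1' : ((2 * r - 1 : ℕ) : ℝ) ^ p.1 ≤ (t ^ 2) ^ p.1 := pow_le_pow_left₀ (by positivity) ht2 _
    have e2 := card_allAv v.toWord p.2 _
      (card_avW_bound hr v.toWord FreeGroup.isReduced_toWord t ht1 htL p.2)
    calc _ ≤ ((2 * r : ℕ) * (t ^ 2) ^ p.1) * ((2 * r : ℕ) * (C * t ^ p.2)) := by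
          refine mul_le_mul (e1.trans ?_) e2 (by positivity) (by positivity)
          gcongr
      _ = (2 * r : ℕ) * ((2 * r : ℕ) * C) * t ^ (2 * p.1 + p.2) := by
          rw [pow_add, pow_mul]; ring
      _ ≤ _ := by
          gcongr
  have h4 : (I.card : ℝ) ≤ (n + 1 : ℝ) ^ 2 := by
    have : I.card ≤ (n + 1) ^ 2 := by
      refine (Finset.card_filter_le _ _).trans ?_
      simp [sq]
    exact_mod_cast this
  calc (ballCount (badSet v) n : ℝ) ≤ T.card := by exact_mod_cast h1
    _ ≤ _ := h2
    _ ≤ ∑ p ∈ I, ((2 * r : ℕ) * ((2 * r : ℕ) * C) * t ^ n : ℝ) := Finset.sum_le_sum h3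
    _ = (I.card : ℝ) * ((2 * r : ℕ) * ((2 * r : ℕ) * C) * t ^ n) := by
        rw [Finset.sum_const, nsmul_eq_mul]
    _ ≤ (n + 1 : ℝ) ^ 2 * ((2 * r : ℕ) * ((2 * r : ℕ) * C) * t ^ n) := by gcongr
    _ = _ := by ring

theorem exists_t (q : ℝ) (hq : 2 < q) (L : ℕ) : ∃ t : ℝ, 1 ≤ t ∧ t < q ∧ q ≤ t ^ 2 ∧
    q ^ L - 1 ≤ t ^ L := by
  have c1 : Filter.Tendsto (fun t : ℝ => t) (nhdsWithin q (Set.Iio q)) (nhds q) :=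
    Filter.tendsto_id.mono_left nhdsWithin_le_nhds
  have e1 := c1.eventually_const_lt (show (1 : ℝ) < q by linarith)
  have e2 := (c1.pow 2).eventually_const_lt (show q < q ^ 2 by nlinarith)
  have e3 := (c1.pow L).eventually_const_lt (show q ^ L - 1 < q ^ L by linarith)
  obtain ⟨t, h1, h2, h3, h4⟩ := (e1.and (e2.and (e3.and self_mem_nhdsWithin))).exists
  exact ⟨t, h1.le, h4, h2.le, h3.le⟩

theorem exp_bound (D θ : ℝ) (hθ : 0 < θ) (hθ1 : θ < 1) : ∃ a : ℝ, 0 < a ∧ ∃ N : ℕ,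
    ∀ n : ℕ, N ≤ n → D * ((n + 1 : ℝ) ^ 2 * θ ^ n) ≤ Real.exp (- a * n) := by
  set s := Real.sqrt θ with hs
  have hs0 : 0 < s := Real.sqrt_pos.2 hθ
  have hss : s * s = θ := Real.mul_self_sqrt hθ.le
  have hs1 : s < 1 := by nlinarith
  have h2 := tendsto_pow_const_mul_const_pow_of_lt_one 2 hs0.le hs1
  have h1 := tendsto_pow_const_mul_const_pow_of_lt_one 1 hs0.le hs1
  have h0 := tendsto_pow_const_mul_const_pow_of_lt_one 0 hs0.le hs1
  have h := ((h2.add (h1.const_mul 2)).add h0).const_mul D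
  have e := h.eventually_le_const (show D * (0 + 2 * 0 + 0) < (1 : ℝ) by simp)
  obtain ⟨N, hN⟩ := Filter.eventually_atTop.1 e
  refine ⟨- Real.log s, by linarith [Real.log_neg hs0 hs1], N, fun n hn => ?_⟩
  have hx : Real.exp (- -Real.log s * n) = s ^ n := by
    rw [neg_neg, mul_comm, Real.exp_nat_mul, Real.exp_log hs0]
  rw [hx, ← hss, mul_pow]
  have := mul_le_mul_of_nonneg_right (hN n hn) (pow_nonneg hs0.le n)
  simp only [pow_zero, pow_one] at this
  nlinarith [this]

/-- if `v` is poison to `P` on an exponentially generic set `A` in `F`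
(no element of `A` whose cyclic reduction contains `v` as a subword lies in `P`),
then `P` is exponentially rare in `F`. -/
theorem poison_implies_expRare {r : ℕ} (hr : 2 ≤ r)
    (P : Set (FreeGroup (Fin r))) (v : FreeGroup (Fin r)) (A : Set (FreeGroup (Fin r)))
    (hA : ExpGeneric A (Set.univ : Set (FreeGroup (Fin r))))
    (hpoison : ∀ w ∈ A,
      (∃ c : FreeGroup (Fin r), IsCyclicReduction c w ∧ Subword v c) → w ∉ P) :
    ExpRare P (Set.univ : Set (FreeGroup (Fin r))) := by
  classical
  have hq : (2 : ℝ) < ((2 * r - 1 : ℕ) : ℝ) := by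
    have : 2 < 2 * r - 1 := by omega
    exact_mod_cast this
  obtain ⟨t, ht1, htq, ht2, htL⟩ := exists_t ((2 * r - 1 : ℕ) : ℝ) hq (v.toWord.length + 1)
  obtain ⟨D, hD, hbad⟩ := bad_count hr v t ht1 ht2 htL
  have hq0 : (0 : ℝ) < ((2 * r - 1 : ℕ) : ℝ) := by linarith
  obtain ⟨a', ha', N', hN'⟩ := exp_bound D (t / ((2 * r - 1 : ℕ) : ℝ)) (by positivity)
    ((div_lt_one hq0).2 htq)
  obtain ⟨a, ha, b, N, hN⟩ := hA
  refine ⟨min a a', lt_min ha ha', max b 0 + Real.log 2, max N N', fun n hn => ?_⟩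
  have hn1 := hN n ((le_max_left _ _).trans hn)
  have hn2 := hN' n ((le_max_right _ _).trans hn)
  have hlow : ((2 * r - 1 : ℕ) : ℝ) ^ n ≤ (ballCount (Set.univ : Set (FreeGroup (Fin r))) n : ℝ) := by
    exact_mod_cast ball_lower hr n
  set U : ℝ := (ballCount (Set.univ : Set (FreeGroup (Fin r))) n : ℝ) with hU
  have hqn : (0 : ℝ) < ((2 * r - 1 : ℕ) : ℝ) ^ n := by positivity
  have hUpos : 0 < U := lt_of_lt_of_le hqn hlow
  have hcount : ballCount A n ≤
      ballCount ((Set.univ : Set (FreeGroup (Fin r))) \ P) n + ballCount (badSet v) n := by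
    rw [ballCount, ballCount, ballCount]
    refine le_trans (Set.ncard_le_ncard ?_ ((finite_ball _ n).union (finite_ball _ n)))
      (Set.ncard_union_le _ _)
    rintro w ⟨hwA, hwn⟩
    by_cases hw : ∃ c : FreeGroup (Fin r), IsCyclicReduction c w ∧ Subword v c
    · exact Or.inl ⟨⟨trivial, hpoison w hwA hw⟩, hwn⟩
    · exact Or.inr ⟨hw, hwn⟩
  have hcount' : (ballCount A n : ℝ) ≤
      ballCount ((Set.univ : Set (FreeGroup (Fin r))) \ P) n + ballCount (badSet v) n := by
    exact_mod_cast hcount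
  have hb : (ballCount (badSet v) n : ℝ) / U ≤ Real.exp (-a' * n) := by
    refine le_trans ?_ hn2
    calc (ballCount (badSet v) n : ℝ) / U
        ≤ (D * ((n + 1 : ℝ) ^ 2 * t ^ n)) / ((2 * r - 1 : ℕ) : ℝ) ^ n :=
          div_le_div₀ (by positivity) (hbad n) hqn hlow
      _ = _ := by rw [div_pow]; ring
  have hdiv := div_le_div_of_nonneg_right hcount' hUpos.le
  rw [add_div] at hdiv
  have hn0 : (0 : ℝ) ≤ n := Nat.cast_nonneg n
  have x1 : Real.exp (b - a * n) ≤ Real.exp (max b 0 - min a a' * n) := by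
    apply Real.exp_le_exp.2
    have := mul_le_mul_of_nonneg_right (min_le_left a a') hn0
    linarith [le_max_left b 0]
  have x2 : Real.exp (-a' * n) ≤ Real.exp (max b 0 - min a a' * n) := by
    apply Real.exp_le_exp.2
    have := mul_le_mul_of_nonneg_right (min_le_right a a') hn0
    linarith [le_max_right b 0]
  have x3 : Real.exp (max b 0 + Real.log 2 - min a a' * n) =
      2 * Real.exp (max b 0 - min a a' * n) := by
    rw [show max b 0 + Real.log 2 - min a a' * n = Real.log 2 + (max b 0 - min a a' * n) by ring,
      Real.exp_add, Real.exp_log (by norm_num)]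
  rw [x3]
  linarith

end VG
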